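/- There exist x_0 > 0 and C > 0 such that for all x ≥ x_0, | (1 − F_k(x)) / ( f_k(x) · (σ²/k) · x^{1−2k} ) − 1 − (σ²/k)·x^{−2k} − ((1−2k)/k²)·σ⁴·x^{−4k} | ≤ C·x^{−6k}; that is, as x → ∞, 1 − F_k(x) = f_k(x)·(σ²/k)·x^{1−2k}·[ 1 + (σ²/k)·x^{−2k} + ((1−2k)/k²)·σ⁴·x^{−4k} + O(x^{−6k}) ]. -/

import Mathlib

open Real Filter Topology Asymptotics

theorem integrableOn_Ioi_rpow_mul_exp_neg_mul_rpow_of_le {n b p x : ℝ} (hn : 0 < n) (hb : 0 < b)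
    (hp : p ≤ n) (hx : 1 ≤ x) :
    MeasureTheory.IntegrableOn (fun t : ℝ => t ^ p * exp (-b * t ^ n)) (Set.Ioi x) := by
  have h1 : MeasureTheory.IntegrableOn (fun t : ℝ => t ^ n * exp (-b * t ^ n)) (Set.Ioi x) :=
    (integrableOn_rpow_mul_exp_neg_mul_rpow (by linarith) hn hb).mono_set
      (Set.Ioi_subset_Ioi (by linarith))
  refine MeasureTheory.Integrable.mono' h1 (by fun_prop) ?_
  filter_upwards [MeasureTheory.ae_restrict_mem measurableSet_Ioi] with t ht
  have ht1 : 1 ≤ t := hx.trans (le_of_lt ht)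
  rw [Real.norm_of_nonneg (by positivity)]
  gcongr

theorem tendsto_rpow_mul_exp_neg_mul_rpow_atTop {n b : ℝ} (hn : 0 < n) (hb : 0 < b) (q : ℝ) :
    Tendsto (fun t : ℝ => t ^ q * exp (-b * t ^ n)) atTop (𝓝 0) := by
  refine ((tendsto_rpow_mul_exp_neg_mul_atTop_nhds_zero (q / n) b hb).comp
    (tendsto_rpow_atTop hn)).congr' ?_
  filter_upwards [eventually_gt_atTop 0] with t ht
  simp only [Function.comp]
  rw [← rpow_mul ht.le, mul_div_cancel₀ _ hn.ne']

theorem integral_Ioi_rpow_mul_exp_neg_mul_rpow_eq {n b p x : ℝ} (hn : 0 < n) (hb : 0 < b)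
    (hp : p ≤ n) (hx : 1 ≤ x) :
    ∫ t in Set.Ioi x, t ^ p * exp (-b * t ^ n) =
      (b * n)⁻¹ * (x ^ (p + 1 - n) * exp (-b * x ^ n) +
        (p + 1 - n) * ∫ t in Set.Ioi x, t ^ (p - n) * exp (-b * t ^ n)) := by
  have hi := integrableOn_Ioi_rpow_mul_exp_neg_mul_rpow_of_le hn hb hp hx
  have hi' := integrableOn_Ioi_rpow_mul_exp_neg_mul_rpow_of_le hn hb
    (show p - n ≤ n by linarith) hx
  have hd : ∀ t ∈ Set.Ici x, HasDerivAt (fun t : ℝ => t ^ (p + 1 - n) * exp (-b * t ^ n))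
      ((p + 1 - n) * (t ^ (p - n) * exp (-b * t ^ n)) -
        b * n * (t ^ p * exp (-b * t ^ n))) t := by
    intro t ht
    have ht0 : 0 < t := by have : x ≤ t := ht; linarith
    have h1 := Real.hasDerivAt_rpow_const (x := t) (p := p + 1 - n) (Or.inl ht0.ne')
    have h2 := ((Real.hasDerivAt_rpow_const (x := t) (p := n) (Or.inl ht0.ne')).const_mul (-b)).exp
    refine (h1.mul h2).congr_deriv ?_
    have e1 : p + 1 - n - 1 = p - n := by ring
    have e2 : t ^ p = t ^ (p + 1 - n) * t ^ (n - 1) := by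
      rw [← rpow_add ht0]; congr 1; ring
    rw [e1, e2]
    ring
  have h := MeasureTheory.integral_Ioi_of_hasDerivAt_of_tendsto' hd
    ((hi'.const_mul (p + 1 - n)).sub (hi.const_mul (b * n)))
    (tendsto_rpow_mul_exp_neg_mul_rpow_atTop hn hb (p + 1 - n))
  rw [MeasureTheory.integral_sub (hi'.const_mul (p + 1 - n)) (hi.const_mul (b * n)),
    MeasureTheory.integral_const_mul, MeasureTheory.integral_const_mul] at h
  rw [eq_inv_mul_iff_mul_eq₀ (by positivity)]
  linarith

theorem integral_Ioi_rpow_mul_exp_neg_mul_rpow_nonneg {n b p x : ℝ} (hx : 0 ≤ x) :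
    0 ≤ ∫ t in Set.Ioi x, t ^ p * exp (-b * t ^ n) := by
  refine MeasureTheory.setIntegral_nonneg measurableSet_Ioi fun t ht => ?_
  have : 0 < t := lt_of_le_of_lt hx ht
  positivity

theorem integral_Ioi_rpow_sub_mul_exp_neg_mul_rpow_le {n b p x : ℝ} (hn : 0 < n) (hb : 0 < b)
    (hp : p ≤ n) (hx : 1 ≤ x) :
    ∫ t in Set.Ioi x, t ^ (p - n) * exp (-b * t ^ n) ≤
      x ^ (-n) * ∫ t in Set.Ioi x, t ^ p * exp (-b * t ^ n) := by
  rw [← MeasureTheory.integral_const_mul]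
  refine MeasureTheory.setIntegral_mono_on
    (integrableOn_Ioi_rpow_mul_exp_neg_mul_rpow_of_le hn hb (by linarith) hx)
    ((integrableOn_Ioi_rpow_mul_exp_neg_mul_rpow_of_le hn hb hp hx).const_mul _)
    measurableSet_Ioi fun t ht => ?_
  have hx0 : 0 < x := by linarith
  have ht0 : 0 < t := hx0.trans ht
  have h : t ^ (-n) ≤ x ^ (-n) :=
    rpow_le_rpow_of_nonpos hx0 (le_of_lt ht) (by linarith)
  rw [sub_eq_add_neg, rpow_add ht0]
  calc t ^ p * t ^ (-n) * exp (-b * t ^ n) = t ^ (-n) * (t ^ p * exp (-b * t ^ n)) := by ring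
    _ ≤ _ := by gcongr

theorem integral_Ioi_rpow_mul_exp_neg_mul_rpow_le {n b p x : ℝ} (hn : 0 < n) (hb : 0 < b)
    (hp : p ≤ n) (hx : 1 ≤ x) (hxn : 2 * ((b * n)⁻¹ * |p + 1 - n|) ≤ x ^ n) :
    ∫ t in Set.Ioi x, t ^ p * exp (-b * t ^ n) ≤
      2 * (b * n)⁻¹ * (x ^ (p + 1 - n) * exp (-b * x ^ n)) := by
  have hx0 : 0 < x := by linarith
  have h1 := integral_Ioi_rpow_mul_exp_neg_mul_rpow_eq hn hb hp hx
  have h2 := integral_Ioi_rpow_sub_mul_exp_neg_mul_rpow_le hn hb hp hx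
  have h0 := integral_Ioi_rpow_mul_exp_neg_mul_rpow_nonneg (n := n) (b := b) (p := p) hx0.le
  have h0' := integral_Ioi_rpow_mul_exp_neg_mul_rpow_nonneg (n := n) (b := b) (p := p - n) hx0.le
  set I := ∫ t in Set.Ioi x, t ^ p * exp (-b * t ^ n)
  set J := ∫ t in Set.Ioi x, t ^ (p - n) * exp (-b * t ^ n)
  have hs : 0 < (b * n)⁻¹ := by positivity
  have hy : 0 < x ^ n := by positivity
  have h3 : (b * n)⁻¹ * ((p + 1 - n) * J) ≤ I / 2 := by
    calc (b * n)⁻¹ * ((p + 1 - n) * J) ≤ (b * n)⁻¹ * (|p + 1 - n| * (x ^ (-n) * I)) := by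
          gcongr
          exact le_abs_self _
      _ = ((b * n)⁻¹ * |p + 1 - n|) * (x ^ n)⁻¹ * I := by rw [rpow_neg hx0.le]; ring
      _ ≤ (x ^ n / 2) * (x ^ n)⁻¹ * I := by gcongr; linarith
      _ = I / 2 := by field_simp
  linarith

theorem integral_abs_rpow_mul_exp_neg_mul_rpow {n b : ℝ} (hn : 0 < n) (hb : 0 < b) :
    ∫ t : ℝ, |t| ^ n * exp (-b * |t| ^ n) =
      2 * (b ^ (-(n + 1) / n) * (1 / n) * Gamma ((n + 1) / n)) := by
  rw [integral_comp_abs (f := fun t : ℝ => t ^ n * exp (-b * t ^ n)),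
    integral_rpow_mul_exp_neg_mul_rpow hn (by linarith) hb]

theorem one_sub_integral_Iio_eq {g : ℝ → ℝ} (h : ∫ t, g t = 1) (x : ℝ) :
    1 - ∫ t in Set.Iio x, g t = ∫ t in Set.Ioi x, g t := by
  have hg : MeasureTheory.Integrable g := by
    by_contra hc
    rw [MeasureTheory.integral_undef hc] at h
    exact zero_ne_one h
  have h1 := MeasureTheory.integral_add_compl (measurableSet_Iio (a := x)) hg
  rw [Set.compl_Iio, MeasureTheory.integral_Ici_eq_integral_Ioi, h] at h1
  linarith

theorem stmt_7
    (k σ : ℝ) (hk : 0 < k) (hσ : 0 < σ)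
    (f F : ℝ → ℝ)
    (hf : ∀ x : ℝ, f x =
      (k / ((2 : ℝ) ^ (1 + 1 / (2 * k)) * σ ^ (2 + 1 / k) * Real.Gamma (1 + 1 / (2 * k)))) *
        |x| ^ (2 * k) * Real.exp (-(|x| ^ (2 * k)) / (2 * σ ^ 2)))
    (hF : ∀ x : ℝ, F x = ∫ t in Set.Iio x, f t)
    : ∃ x₀ > (0 : ℝ), ∃ C > (0 : ℝ), ∀ x : ℝ, x₀ ≤ x →
      |(1 - F x) / (f x * (σ ^ 2 / k) * x ^ (1 - 2 * k)) - 1 - (σ ^ 2 / k) * x ^ (-(2 * k)) -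
          ((1 - 2 * k) / k ^ 2) * σ ^ 4 * x ^ (-(4 * k))| ≤
        C * x ^ (-(6 * k)) := by
  have hG : 0 < Gamma (1 + 1 / (2 * k)) := Gamma_pos_of_pos (by positivity)
  set A := k / ((2 : ℝ) ^ (1 + 1 / (2 * k)) * σ ^ (2 + 1 / k) * Gamma (1 + 1 / (2 * k))) with hA
  have hA0 : 0 < A := by positivity
  obtain ⟨b, hb⟩ : ∃ b : ℝ, b = (2 * σ ^ 2)⁻¹ := ⟨_, rfl⟩
  have hb0 : 0 < b := by rw [hb]; positivity
  obtain ⟨n, hn⟩ : ∃ n : ℝ, n = 2 * k := ⟨_, rfl⟩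
  have hn0 : 0 < n := by rw [hn]; positivity
  have hs : (b * n)⁻¹ = σ ^ 2 / k := by rw [hb, hn]; field_simp
  have hf' : ∀ x, f x = A * (|x| ^ n * exp (-b * |x| ^ n)) := by
    intro x
    rw [hf, hb, hn, mul_assoc]
    congr 3
    ring
  have hf1 : ∫ t, f t = 1 := by
    simp_rw [hf']
    rw [MeasureTheory.integral_const_mul, integral_abs_rpow_mul_exp_neg_mul_rpow hn0 hb0]
    have e1 : (n + 1) / n = 1 + 1 / (2 * k) := by rw [hn]; field_simp
    have e2 : b ^ (-(n + 1) / n) = 2 ^ (1 + 1 / (2 * k)) * σ ^ (2 + 1 / k) := by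
      rw [neg_div, e1, hb, inv_rpow (by positivity), rpow_neg (by positivity), inv_inv,
        mul_rpow (by positivity) (by positivity), ← rpow_natCast σ 2, ← rpow_mul hσ.le]
      congr 2
      push_cast
      field_simp
    rw [e2, e1, hA, hn]
    field_simp
  obtain ⟨y, hy⟩ := (tendsto_atTop.1 (tendsto_rpow_atTop hn0)
    (2 * ((b * n)⁻¹ * |-2 * n + 1 - n|))).exists_forall_of_atTop
  refine ⟨max 1 y, by positivity, 2 * (σ ^ 2 / k) ^ 3 * |(1 - n) * (1 - 2 * n)| + 1,
    by positivity, fun x hx => ?_⟩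
  have hx1 : 1 ≤ x := (le_max_left _ _).trans hx
  have hx0 : 0 < x := by linarith
  have hT : 1 - F x = A * ∫ t in Set.Ioi x, t ^ n * exp (-b * t ^ n) := by
    rw [hF, one_sub_integral_Iio_eq hf1, ← MeasureTheory.integral_const_mul]
    refine MeasureTheory.setIntegral_congr_fun measurableSet_Ioi fun t ht => ?_
    simp only [hf', abs_of_pos (hx0.trans ht)]
  have r0 := integral_Ioi_rpow_mul_exp_neg_mul_rpow_eq hn0 hb0 le_rfl hx1
  have r1 := integral_Ioi_rpow_mul_exp_neg_mul_rpow_eq hn0 hb0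
    (show n - n ≤ n by linarith) hx1
  have r2 := integral_Ioi_rpow_mul_exp_neg_mul_rpow_eq hn0 hb0
    (show n - n - n ≤ n by linarith) hx1
  have e3 : n - n - n - n = -2 * n := by ring
  have r3 := integral_Ioi_rpow_mul_exp_neg_mul_rpow_le hn0 hb0
    (show -2 * n ≤ n by linarith) hx1 (hy x ((le_max_right _ _).trans hx))
  have r3' := integral_Ioi_rpow_mul_exp_neg_mul_rpow_nonneg (n := n) (b := b) (p := -2 * n) hx0.le
  rw [e3] at r2
  rw [r2] at r1
  rw [r1] at r0
  rw [r0] at hT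
  set I := ∫ t in Set.Ioi x, t ^ (-2 * n) * exp (-b * t ^ n)
  have hE : 0 < exp (-b * x ^ n) := exp_pos _
  have hfx : f x * (σ ^ 2 / k) * x ^ (1 - 2 * k) =
      A * (σ ^ 2 / k) * x * exp (-b * x ^ n) := by
    have h : x ^ n * x ^ (1 - 2 * k) = x := by
      rw [← rpow_add hx0, hn, add_sub_cancel, rpow_one]
    rw [hf', abs_of_pos hx0]
    linear_combination A * (σ ^ 2 / k) * exp (-b * x ^ n) * h
  have p0 : x ^ (n + 1 - n) = x := by rw [add_sub_cancel_left, rpow_one]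
  have p1 : x ^ (n - n + 1 - n) = x * x ^ (-(2 * k)) := by
    nth_rewrite 2 [← rpow_one x]; rw [← rpow_add hx0, hn]; congr 1; ring
  have p2 : x ^ (n - n - n + 1 - n) = x * x ^ (-(4 * k)) := by
    nth_rewrite 2 [← rpow_one x]; rw [← rpow_add hx0, hn]; congr 1; ring
  have p3 : x ^ (-2 * n + 1 - n) = x * x ^ (-(6 * k)) := by
    nth_rewrite 2 [← rpow_one x]; rw [← rpow_add hx0, hn]; congr 1; ring
  rw [p3, hs] at r3
  rw [p0, p1, p2, hs] at hT
  have hR : (1 - F x) / (f x * (σ ^ 2 / k) * x ^ (1 - 2 * k)) - 1 - (σ ^ 2 / k) * x ^ (-(2 * k)) -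
      ((1 - 2 * k) / k ^ 2) * σ ^ 4 * x ^ (-(4 * k)) =
      (σ ^ 2 / k) ^ 2 * ((1 - n) * (1 - 2 * n)) * (I / (x * exp (-b * x ^ n))) := by
    rw [hT, hfx, ← hn]
    generalize x ^ (-(4 * k)) = u
    generalize x ^ (-n) = v
    generalize exp (-b * x ^ n) = E at hE ⊢
    field_simp
    ring
  have hI : I / (x * exp (-b * x ^ n)) ≤ 2 * (σ ^ 2 / k) * x ^ (-(6 * k)) := by
    rw [div_le_iff₀ (by positivity)]
    linarith
  have hI0 : 0 ≤ I / (x * exp (-b * x ^ n)) := by positivity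
  have hw : 0 < x ^ (-(6 * k)) := by positivity
  rw [hR, abs_mul, abs_mul, abs_of_nonneg hI0, abs_of_nonneg (sq_nonneg _)]
  calc _ ≤ (σ ^ 2 / k) ^ 2 * |(1 - n) * (1 - 2 * n)| * (2 * (σ ^ 2 / k) * x ^ (-(6 * k))) := by
        gcongr
    _ ≤ _ := by linarith
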